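/- Let F = {f_1,…,f_N} and G = {g_1,…,g_N} be post-critically finite IFSs of contracting similitudes on complete metric spaces (X,d_1) and (Y,d_2), with attractors K, K' and contraction ratios r_i, r'_i respectively. Assume both F and G satisfy the single intersection condition and the angle separation condition, and that F and G have the same topology automaton, rendered combinatorially as: for every n ≥ 1 and all words I, J ∈ {1,…,N}^n, f_I(K) ∩ f_J(K) = ∅ if and only if g_I(K') ∩ g_J(K') = ∅. If r_i = r'_i for every i ∈ {1,…,N}, then (K,d_1) and (K',d_2) are Lipschitz equivalent: there exist a bijection h : K → K' and constants 0 < A ≤ B < ∞ such that A·d_1(x,y) ≤ d_2(h(x),h(y)) ≤ B·d_1(x,y) for all x,y ∈ K. -/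

import Mathlib

open Set Metric
open scoped ENNReal

/-- `wordMap f [i₁,…,i_k] = f i₁ ∘ ⋯ ∘ f i_k`. -/
def wordMap {X : Type*} {ι : Type*} (f : ι → X → X) : List ι → X → X
  | [] => id
  | i :: I => f i ∘ wordMap f I

/-- The prefix word `x₁ ⋯ x_n` of an infinite word `x`. -/
def pre {ι : Type*} (x : ℕ → ι) (n : ℕ) : List ι := List.ofFn (fun j : Fin n => x j)

/-- `K` is the attractor of the IFS `f`: the (unique) nonempty compact set with
`K = ⋃ i, f i '' K`. -/
def IsAttractor {X : Type*} [MetricSpace X] {ι : Type*} (f : ι → X → X) (K : Set X) : Prop :=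
  K.Nonempty ∧ IsCompact K ∧ K = ⋃ i, f i '' K

/-- `g` is a bi-Lipschitz contraction. -/
def IsBiLipContraction {X : Type*} [MetricSpace X] (g : X → X) : Prop :=
  ∃ A B : ℝ, 0 < A ∧ B < 1 ∧ ∀ x y : X,
    A * dist x y ≤ dist (g x) (g y) ∧ dist (g x) (g y) ≤ B * dist x y

/-- `g` is a similitude of ratio `r`. -/
def IsSimilitude {X : Type*} [MetricSpace X] (g : X → X) (r : ℝ) : Prop :=
  ∀ x y : X, dist (g x) (g y) = r * dist x y

/-- The critical set `C_F = ⋃_{i ≠ j} f_i(K) ∩ f_j(K)`. -/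
def criticalSet {X : Type*} {ι : Type*} (f : ι → X → X) (K : Set X) : Set X :=
  ⋃ (i : ι) (j : ι) (_ : i ≠ j), (f i '' K) ∩ (f j '' K)

/-- The post-critical set `P_F = ⋃_{ω ∈ Σ^*} f_ω⁻¹(C_F) ∩ K`. -/
def postCriticalSet {X : Type*} {ι : Type*} (f : ι → X → X) (K : Set X) : Set X :=
  {p | p ∈ K ∧ ∃ I : List ι, I ≠ [] ∧ wordMap f I p ∈ criticalSet f K}

/-- `π` is the coding map of `(f, K)`: `{π x} = ⋂_k f_{x₁⋯x_k}(K)`. -/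
def IsCodingMap {X : Type*} {ι : Type*} (f : ι → X → X) (K : Set X)
    (π : (ℕ → ι) → X) : Prop :=
  ∀ x : ℕ → ι, (⋂ k : ℕ, wordMap f (pre x (k + 1)) '' K) = {π x}

/-- Single intersection condition: `f_i(K) ∩ f_j(K)` contains at most one point for `i ≠ j`. -/
def SIC {X : Type*} {ι : Type*} (f : ι → X → X) (K : Set X) : Prop :=
  ∀ i j : ι, i ≠ j → ((f i '' K) ∩ (f j '' K)).Subsingleton

/-- Angle separation condition with respect to a distance function `D`. -/
def ASCwrt {X : Type*} {ι : Type*} (f : ι → X → X) (K : Set X) (D : X → X → ℝ) : Prop :=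
  ∃ c : ℝ, 0 < c ∧ ∀ i j : ι, i ≠ j → ∀ z : X, (f i '' K) ∩ (f j '' K) = {z} →
    ∀ x ∈ f i '' K, ∀ y ∈ f j '' K, c * max (D x z) (D y z) ≤ D x y

/-- Angle separation condition. -/
def ASC {X : Type*} [MetricSpace X] {ι : Type*} (f : ι → X → X) (K : Set X) : Prop :=
  ASCwrt f K dist

/-- Lexicographic order on infinite words. -/
def lexLe {ι : Type*} [LinearOrder ι] (x y : ℕ → ι) : Prop :=
  x = y ∨ ∃ n : ℕ, (∀ k < n, x k = y k) ∧ x n < y n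

/-- `Σ_K`: the set of lowest codings, i.e. of words that are lexicographically least
among all words with the same image under the coding map `π`. -/
def lowestCodings {X : Type*} {ι : Type*} [LinearOrder ι] (π : (ℕ → ι) → X) :
    Set (ℕ → ι) :=
  {x | ∀ y : ℕ → ι, π y = π x → lexLe x y}

/-- `∂Σ_K`: the set of first letters of codings of post-critical points. -/
def bdryLetters {X : Type*} {ι : Type*} (f : ι → X → X) (K : Set X)
    (π : (ℕ → ι) → X) : Set ι :=
  {i | ∃ x : ℕ → ι, π x ∈ postCriticalSet f K ∧ x 0 = i}

/-- The contraction ratio `r_I = r_{i₁} ⋯ r_{i_k}` of a word. -/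
def rword {ι : Type*} (r : ι → ℝ) (I : List ι) : ℝ := (I.map r).prod

/-- The infinite word `i x₀ x₁ ⋯`. -/
def consWord {ι : Type*} (i : ι) (x : ℕ → ι) : ℕ → ι
  | 0 => i
  | n + 1 => x n

/-- The shifted infinite word `x₁ x₂ ⋯`. -/
def shiftWord {ι : Type*} (x : ℕ → ι) : ℕ → ι := fun n => x (n + 1)

theorem pre_succ {ι : Type*} (x : ℕ → ι) (n : ℕ) :
    pre x (n + 1) = x 0 :: pre (shiftWord x) n := by
  simp [pre, shiftWord, List.ofFn_succ]

theorem length_pre {ι : Type*} (x : ℕ → ι) (n : ℕ) : (pre x n).length = n := by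
  simp [pre]

theorem wordMap_append {X ι : Type*} (f : ι → X → X) (I J : List ι) (x : X) :
    wordMap f (I ++ J) x = wordMap f I (wordMap f J x) := by
  induction I with
  | nil => rfl
  | cons i I ih => simp [wordMap, ih]

theorem IsAttractor.map_mem {X ι : Type*} [MetricSpace X] {f : ι → X → X} {K : Set X}
    (hK : IsAttractor f K) (i : ι) {x : X} (hx : x ∈ K) : f i x ∈ K := by
  rw [hK.2.2]
  exact mem_iUnion.2 ⟨i, x, hx, rfl⟩

theorem IsAttractor.wordMap_mem {X ι : Type*} [MetricSpace X] {f : ι → X → X} {K : Set X}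
    (hK : IsAttractor f K) (I : List ι) {x : X} (hx : x ∈ K) : wordMap f I x ∈ K := by
  induction I with
  | nil => exact hx
  | cons i I ih => exact hK.map_mem i ih

theorem IsCodingMap.mem_image {X ι : Type*} {f : ι → X → X} {K : Set X} {π : (ℕ → ι) → X}
    (hπ : IsCodingMap f K π) (x : ℕ → ι) (k : ℕ) : π x ∈ wordMap f (pre x (k + 1)) '' K := by
  have h : π x ∈ ⋂ k : ℕ, wordMap f (pre x (k + 1)) '' K := by rw [hπ x]; rfl
  exact mem_iInter.1 h k

theorem IsCodingMap.eq_of_forall_mem {X ι : Type*} {f : ι → X → X} {K : Set X}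
    {π : (ℕ → ι) → X} (hπ : IsCodingMap f K π) {x : ℕ → ι} {p : X}
    (h : ∀ k, p ∈ wordMap f (pre x (k + 1)) '' K) : p = π x := by
  have h' := mem_iInter.2 h
  rw [hπ x] at h'
  exact h'

theorem IsCodingMap.mem {X ι : Type*} [MetricSpace X] {f : ι → X → X} {K : Set X}
    {π : (ℕ → ι) → X} (hK : IsAttractor f K) (hπ : IsCodingMap f K π) (x : ℕ → ι) :
    π x ∈ K := by
  obtain ⟨p, hp, h⟩ := hπ.mem_image x 0
  exact h ▸ hK.wordMap_mem _ hp

theorem IsCodingMap.eq_map_shift {X ι : Type*} [MetricSpace X] {f : ι → X → X} {K : Set X}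
    {π : (ℕ → ι) → X} (hK : IsAttractor f K) (hπ : IsCodingMap f K π) (x : ℕ → ι) :
    π x = f (x 0) (π (shiftWord x)) := by
  refine (hπ.eq_of_forall_mem fun k => ?_).symm
  rw [pre_succ]
  cases k with
  | zero => exact ⟨_, hπ.mem hK _, rfl⟩
  | succ k =>
    obtain ⟨p, hp, h⟩ := hπ.mem_image (shiftWord x) k
    exact ⟨p, hp, congrArg (f (x 0)) h⟩

theorem IsCodingMap.map_consWord {X ι : Type*} [MetricSpace X] {f : ι → X → X} {K : Set X}
    {π : (ℕ → ι) → X} (hK : IsAttractor f K) (hπ : IsCodingMap f K π) (i : ι) (x : ℕ → ι) :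
    π (consWord i x) = f i (π x) :=
  hπ.eq_map_shift hK (consWord i x)

theorem IsCodingMap.surjOn {X ι : Type*} [MetricSpace X] {f : ι → X → X} {K : Set X}
    {π : (ℕ → ι) → X} (hK : IsAttractor f K) (hπ : IsCodingMap f K π) {p : X} (hp : p ∈ K) :
    ∃ x, π x = p := by
  have hstep : ∀ p : K, ∃ i : ι, ∃ q : K, f i q = p := by
    rintro ⟨p, hp⟩
    rw [hK.2.2] at hp
    obtain ⟨i, q, hq, h⟩ := mem_iUnion.1 hp
    exact ⟨i, ⟨q, hq⟩, h⟩
  choose c s hcs using hstep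
  have key : ∀ (n : ℕ) (p : K), wordMap f (pre (fun k => c (s^[k] p)) n) (s^[n] p) = p := by
    intro n
    induction n with
    | zero => intro p; rfl
    | succ n ih =>
      intro p
      rw [pre_succ]
      have h := ih (s p)
      simp only [← Function.iterate_succ_apply] at h
      exact (congrArg (f (c p)) h).trans (hcs p)
  exact ⟨_, (hπ.eq_of_forall_mem fun k => ⟨_, Subtype.prop _, key (k + 1) ⟨p, hp⟩⟩).symm⟩

theorem mem_postCriticalSet_of_map {X ι : Type*} {f : ι → X → X} {K : Set X} {i : ι} {q : X}
    (hq : q ∈ K) (h : f i q ∈ postCriticalSet f K) : q ∈ postCriticalSet f K := by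
  obtain ⟨_, I, hI, hmem⟩ := h
  refine ⟨hq, I ++ [i], by simp, ?_⟩
  rw [wordMap_append]
  exact hmem

theorem mem_postCriticalSet_of_map_mem_inter {X ι : Type*} {f : ι → X → X} {K : Set X}
    {i j : ι} (hij : i ≠ j) {q : X} (hq : q ∈ K) (h : f i q ∈ f i '' K ∩ f j '' K) :
    q ∈ postCriticalSet f K :=
  ⟨hq, [i], by simp, mem_iUnion.2 ⟨i, mem_iUnion.2 ⟨j, mem_iUnion.2 ⟨hij, h⟩⟩⟩⟩

theorem exists_pos_le_dist_of_disjoint {X α : Type*} [MetricSpace X] [Finite α]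
    {s t : α → Set X} (hs : ∀ a, IsCompact (s a)) (ht : ∀ a, IsCompact (t a)) :
    ∃ δ : ℝ, 0 < δ ∧ ∀ a, Disjoint (s a) (t a) → ∀ x ∈ s a, ∀ y ∈ t a, δ ≤ dist x y := by
  have h : ∀ a, ∃ δ : ℝ, 0 < δ ∧
      (Disjoint (s a) (t a) → ∀ x ∈ s a, ∀ y ∈ t a, δ ≤ dist x y) := by
    intro a
    by_cases hd : Disjoint (s a) (t a)
    · obtain ⟨δ, hδ, h⟩ := exists_pos_forall_lt_edist (hs a) (ht a).isClosed hd
      refine ⟨δ, hδ, fun _ x hx y hy => ?_⟩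
      have := h x hx y hy
      rw [edist_nndist] at this
      exact_mod_cast this.le
    · exact ⟨1, one_pos, fun h => absurd h hd⟩
  choose δ hδ h using h
  cases isEmpty_or_nonempty α
  · exact ⟨1, one_pos, fun a => isEmptyElim a⟩
  · obtain ⟨a₀, h₀⟩ := Finite.exists_min δ
    exact ⟨δ a₀, hδ a₀, fun a hd x hx y hy => (h₀ a).trans (h a hd x hx y hy)⟩

theorem IsSimilitude.continuous {X : Type*} [MetricSpace X] {g : X → X} {r : ℝ} (hr : 0 < r)
    (hg : IsSimilitude g r) : Continuous g :=
  (LipschitzWith.of_dist_le_mul (K := ⟨r, hr.le⟩) fun x y => (hg x y).le).continuous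

theorem dist_wordMap_le {Y ι : Type*} [MetricSpace Y] {g : ι → Y → Y} {K : Set Y}
    {r : ι → ℝ} {ρ M : ℝ} (hg : ∀ i, IsSimilitude (g i) (r i))
    (hρ : 0 ≤ ρ) (hr : ∀ i, r i ≤ ρ) (hM : ∀ x ∈ K, ∀ y ∈ K, dist x y ≤ M) (I : List ι) :
    ∀ x ∈ K, ∀ y ∈ K, dist (wordMap g I x) (wordMap g I y) ≤ ρ ^ I.length * M := by
  intro x hx y hy
  induction I with
  | nil => simpa [wordMap] using hM x hx y hy
  | cons i I ih =>
    calc dist (g i (wordMap g I x)) (g i (wordMap g I y))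
        = r i * dist (wordMap g I x) (wordMap g I y) := hg i _ _
      _ ≤ ρ * (ρ ^ I.length * M) :=
        mul_le_mul (hr i) ih dist_nonneg hρ
      _ = ρ ^ (i :: I).length * M := by rw [List.length_cons, pow_succ]; ring

theorem le_of_forall_le_add_pow_mul {a b ρ M : ℝ} (hρ : 0 ≤ ρ) (hρ1 : ρ < 1)
    (h : ∀ n : ℕ, a ≤ b + ρ ^ n * M) : a ≤ b := by
  have hlim : Filter.Tendsto (fun n : ℕ => b + ρ ^ n * M) Filter.atTop (nhds (b + 0 * M)) :=
    ((tendsto_pow_atTop_nhds_zero_of_lt_one hρ hρ1).mul_const M).const_add b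
  simpa using ge_of_tendsto' hlim h

theorem exists_uniform_ratio {ι : Type*} [Finite ι] {r : ι → ℝ}
    (hr : ∀ i, 0 < r i ∧ r i < 1) : ∃ ρ : ℝ, 0 ≤ ρ ∧ ρ < 1 ∧ ∀ i, r i ≤ ρ := by
  cases isEmpty_or_nonempty ι
  · exact ⟨0, le_rfl, one_pos, fun i => isEmptyElim i⟩
  · obtain ⟨i, hi⟩ := Finite.exists_max r
    exact ⟨r i, (hr i).1.le, (hr i).2, hi⟩

theorem IsAttractor.exists_dist_le {X ι : Type*} [MetricSpace X] {f : ι → X → X} {K : Set X}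
    (hK : IsAttractor f K) : ∃ M : ℝ, 0 ≤ M ∧ ∀ x ∈ K, ∀ y ∈ K, dist x y ≤ M := by
  obtain ⟨M, hM⟩ := Metric.isBounded_iff.1 hK.2.1.isBounded
  obtain ⟨p, hp⟩ := hK.1
  exact ⟨M, dist_nonneg.trans (hM hp hp), fun x hx y hy => hM hx hy⟩

/-- Identifications made by the first coding map are made by the second one, as soon as words
with intersecting cylinders for the first IFS have intersecting cylinders for the second. -/
theorem codingMap_eq_of_codingMap_eq {X Y ι : Type*} [MetricSpace Y] [Finite ι]
    {f : ι → X → X} {g : ι → Y → Y} {K : Set X} {K' : Set Y} {r : ι → ℝ}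
    {πF : (ℕ → ι) → X} {πG : (ℕ → ι) → Y}
    (hr : ∀ i, 0 < r i ∧ r i < 1) (hg : ∀ i, IsSimilitude (g i) (r i))
    (hK' : IsAttractor g K') (hπF : IsCodingMap f K πF) (hπG : IsCodingMap g K' πG)
    (hauto : ∀ I J : List ι, I ≠ [] → I.length = J.length →
      (wordMap g I '' K') ∩ (wordMap g J '' K') = ∅ →
        (wordMap f I '' K) ∩ (wordMap f J '' K) = ∅)
    {x y : ℕ → ι} (hxy : πF x = πF y) : πG x = πG y := by
  obtain ⟨ρ, hρ, hρ1, hrρ⟩ := exists_uniform_ratio hr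
  obtain ⟨M, hM0, hM⟩ := hK'.exists_dist_le
  refine dist_le_zero.1 (le_of_forall_le_add_pow_mul (M := 2 * M) hρ hρ1 fun n => ?_)
  have hne : (wordMap g (pre x (n + 1)) '' K' ∩ wordMap g (pre y (n + 1)) '' K').Nonempty := by
    rw [nonempty_iff_ne_empty]
    intro h
    have h' := hauto _ _ (by simp [pre_succ]) (by simp [length_pre]) h
    exact (h' ▸ (⟨hπF.mem_image x n, hxy ▸ hπF.mem_image y n⟩ :
      πF x ∈ wordMap f (pre x (n + 1)) '' K ∩ wordMap f (pre y (n + 1)) '' K) :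
      πF x ∈ (∅ : Set X))
  obtain ⟨z, ⟨a, ha, haz⟩, ⟨b, hb, hbz⟩⟩ := hne
  obtain ⟨p, hp, hpx⟩ := hπG.mem_image x n
  obtain ⟨q, hq, hqy⟩ := hπG.mem_image y n
  have h1 := dist_wordMap_le hg hρ hrρ hM (pre x (n + 1)) p hp a ha
  have h2 := dist_wordMap_le hg hρ hrρ hM (pre y (n + 1)) b hb q hq
  rw [hpx, haz, length_pre] at h1
  rw [hbz, hqy, length_pre] at h2
  have h3 : ρ ^ (n + 1) * M ≤ ρ ^ n * M :=
    mul_le_mul_of_nonneg_right (pow_le_pow_of_le_one hρ hρ1.le n.le_succ) hM0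
  linarith [dist_triangle (πG x) z (πG y)]

/-- Lipschitz estimate at post-critical points. -/
theorem exists_dist_le_mul_dist_of_mem_postCriticalSet {X Y ι : Type*}
    [MetricSpace X] [MetricSpace Y] [Finite ι]
    {f : ι → X → X} {g : ι → Y → Y} {K : Set X} {K' : Set Y} {r : ι → ℝ}
    {πF : (ℕ → ι) → X} {πG : (ℕ → ι) → Y}
    (hr : ∀ i, 0 < r i ∧ r i < 1)
    (hf : ∀ i, IsSimilitude (f i) (r i)) (hg : ∀ i, IsSimilitude (g i) (r i))
    (hK : IsAttractor f K) (hK' : IsAttractor g K')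
    (hπF : IsCodingMap f K πF) (hπG : IsCodingMap g K' πG)
    (hpcf : (πF ⁻¹' postCriticalSet f K).Finite)
    (hFG : ∀ x y, πF x = πF y → πG x = πG y) :
    ∃ B : ℝ, 0 < B ∧ ∀ x p, πF p ∈ postCriticalSet f K →
      dist (πG x) (πG p) ≤ B * dist (πF x) (πF p) := by
  obtain ⟨ρ, hρ, hρ1, hrρ⟩ := exists_uniform_ratio hr
  obtain ⟨M, hM0, hM⟩ := hK'.exists_dist_le
  have := hpcf.to_subtype
  obtain ⟨δ, hδ, hsep⟩ := exists_pos_le_dist_of_disjoint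
    (s := fun a : ι × (πF ⁻¹' postCriticalSet f K) => f a.1 '' K) (t := fun a => {πF a.2})
    (fun a => hK.2.1.image ((hf a.1).continuous (hr a.1).1)) (fun a => isCompact_singleton)
  refine ⟨(M + 1) / δ, by positivity, fun x p hp => ?_⟩
  refine le_of_forall_le_add_pow_mul (M := M) hρ hρ1 fun n => ?_
  induction n generalizing x p with
  | zero =>
    have h1 := hM _ (hπG.mem hK' x) _ (hπG.mem hK' p)
    have h2 : 0 ≤ (M + 1) / δ * dist (πF x) (πF p) := by positivity
    simpa using by linarith
  | succ n ih =>
    have hx := hπF.eq_map_shift hK x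
    have hx' := hπG.eq_map_shift hK' x
    by_cases hpi : πF p ∈ f (x 0) '' K
    · obtain ⟨q, hq, hqp⟩ := hpi
      obtain ⟨ω, rfl⟩ := hπF.surjOn hK hq
      have hω : πF ω ∈ postCriticalSet f K := mem_postCriticalSet_of_map hq (hqp ▸ hp)
      have hpG : πG p = g (x 0) (πG ω) := by
        rw [← hπG.map_consWord hK']
        exact hFG _ _ (by rw [hπF.map_consWord hK, hqp])
      rw [hx, hx', ← hqp, hpG, hf, hg]
      calc r (x 0) * dist (πG (shiftWord x)) (πG ω)
          ≤ r (x 0) * ((M + 1) / δ * dist (πF (shiftWord x)) (πF ω) + ρ ^ n * M) :=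
            mul_le_mul_of_nonneg_left (ih _ _ hω) (hr _).1.le
        _ = (M + 1) / δ * (r (x 0) * dist (πF (shiftWord x)) (πF ω))
            + r (x 0) * (ρ ^ n * M) := by ring
        _ ≤ (M + 1) / δ * (r (x 0) * dist (πF (shiftWord x)) (πF ω)) + ρ * (ρ ^ n * M) := by
            gcongr
            exact hrρ _
        _ = _ := by rw [pow_succ]; ring
    · have hd : δ ≤ dist (πF x) (πF p) :=
        hsep (x 0, ⟨p, hp⟩) (disjoint_singleton_right.2 hpi) _
          (hx ▸ mem_image_of_mem _ (hπF.mem hK _)) _ rfl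
      have h1 := hM _ (hπG.mem hK' x) _ (hπG.mem hK' p)
      have h2 : (M + 1) / δ * δ ≤ (M + 1) / δ * dist (πF x) (πF p) := by gcongr
      rw [div_mul_cancel₀ _ hδ.ne'] at h2
      have h3 : 0 ≤ ρ ^ (n + 1) * M := by positivity
      linarith

/-- The correspondence `πF x ↦ πG x` is Lipschitz. -/
theorem exists_dist_codingMap_le_mul_dist {X Y ι : Type*}
    [MetricSpace X] [MetricSpace Y] [Finite ι]
    {f : ι → X → X} {g : ι → Y → Y} {K : Set X} {K' : Set Y} {r : ι → ℝ}
    {πF : (ℕ → ι) → X} {πG : (ℕ → ι) → Y}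
    (hr : ∀ i, 0 < r i ∧ r i < 1)
    (hf : ∀ i, IsSimilitude (f i) (r i)) (hg : ∀ i, IsSimilitude (g i) (r i))
    (hK : IsAttractor f K) (hK' : IsAttractor g K')
    (hπF : IsCodingMap f K πF) (hπG : IsCodingMap g K' πG)
    (hpcf : (πF ⁻¹' postCriticalSet f K).Finite) (hSIC : SIC f K) (hASC : ASC f K)
    (hFG : ∀ x y, πF x = πF y → πG x = πG y) :
    ∃ B : ℝ, 0 < B ∧ ∀ x y, dist (πG x) (πG y) ≤ B * dist (πF x) (πF y) := by
  obtain ⟨ρ, hρ, hρ1, hrρ⟩ := exists_uniform_ratio hr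
  obtain ⟨M, hM0, hM⟩ := hK'.exists_dist_le
  obtain ⟨B, hB, hpost⟩ := exists_dist_le_mul_dist_of_mem_postCriticalSet
    hr hf hg hK hK' hπF hπG hpcf hFG
  obtain ⟨c, hc, hasc⟩ := hASC
  have hcomp : ∀ i, IsCompact (f i '' K) := fun i =>
    hK.2.1.image ((hf i).continuous (hr i).1)
  obtain ⟨δ, hδ, hsep⟩ := exists_pos_le_dist_of_disjoint
    (s := fun a : ι × ι => f a.1 '' K) (t := fun a => f a.2 '' K)
    (fun a => hcomp a.1) (fun a => hcomp a.2)
  -- Distance to an intersection point of first level cylinders.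
  have hcrit : ∀ x z i j, i ≠ j → x 0 = i → πF z ∈ f i '' K ∩ f j '' K →
      dist (πG x) (πG z) ≤ B * dist (πF x) (πF z) := by
    rintro x z i j hij rfl hz
    obtain ⟨q, hq, hqz⟩ := hz.1
    obtain ⟨ω, rfl⟩ := hπF.surjOn hK hq
    have hω := mem_postCriticalSet_of_map_mem_inter hij hq (hqz ▸ hz)
    have hzG : πG z = g (x 0) (πG ω) := by
      rw [← hπG.map_consWord hK']
      exact hFG _ _ (by rw [hπF.map_consWord hK, hqz])
    rw [hπF.eq_map_shift hK x, hπG.eq_map_shift hK' x, ← hqz, hzG, hf, hg, mul_left_comm]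
    exact mul_le_mul_of_nonneg_left (hpost _ _ hω) (hr _).1.le
  have hbase : ∀ x y : ℕ → ι, x 0 ≠ y 0 →
      dist (πG x) (πG y) ≤ (2 * B / c + M / δ) * dist (πF x) (πF y) := by
    intro x y hxy
    have hx : πF x ∈ f (x 0) '' K :=
      hπF.eq_map_shift hK x ▸ mem_image_of_mem _ (hπF.mem hK _)
    have hy : πF y ∈ f (y 0) '' K :=
      hπF.eq_map_shift hK y ▸ mem_image_of_mem _ (hπF.mem hK _)
    have hBc : 0 ≤ 2 * B / c * dist (πF x) (πF y) := by positivity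
    have hMδ : 0 ≤ M / δ * dist (πF x) (πF y) := by positivity
    rw [add_mul]
    rcases (hSIC _ _ hxy).eq_empty_or_singleton with h | ⟨z, h⟩
    · have hd := hsep (x 0, y 0) (disjoint_iff_inter_eq_empty.2 h) _ hx _ hy
      have h1 := hM _ (hπG.mem hK' x) _ (hπG.mem hK' y)
      have h2 : M / δ * δ ≤ M / δ * dist (πF x) (πF y) := by gcongr
      rw [div_mul_cancel₀ _ hδ.ne'] at h2
      linarith
    · have hz : z ∈ f (x 0) '' K ∩ f (y 0) '' K := h ▸ mem_singleton z
      have hzK : z ∈ K := by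
        obtain ⟨q, hq, rfl⟩ := hz.1
        exact hK.map_mem _ hq
      obtain ⟨ω, rfl⟩ := hπF.surjOn hK hzK
      have h1 := hcrit x ω _ _ hxy rfl hz
      have h2 := hcrit y ω _ _ hxy.symm rfl hz.symm
      have h3 := hasc _ _ hxy _ h _ hx _ hy
      set m := max (dist (πF x) (πF ω)) (dist (πF y) (πF ω))
      have h4 : B * dist (πF x) (πF ω) ≤ B * m := by gcongr; exact le_max_left _ _
      have h5 : B * dist (πF y) (πF ω) ≤ B * m := by gcongr; exact le_max_right _ _
      have h6 : 2 * B / c * (c * m) ≤ 2 * B / c * dist (πF x) (πF y) := by gcongr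
      have h7 : 2 * B / c * (c * m) = 2 * B * m := by field_simp
      linarith [dist_triangle_right (πG x) (πG y) (πG ω)]
  refine ⟨2 * B / c + M / δ, by positivity, fun x y => ?_⟩
  refine le_of_forall_le_add_pow_mul (M := M) hρ hρ1 fun n => ?_
  set C := 2 * B / c + M / δ
  have hC : 0 ≤ C := by positivity
  induction n generalizing x y with
  | zero =>
    have h1 := hM _ (hπG.mem hK' x) _ (hπG.mem hK' y)
    have h2 : 0 ≤ C * dist (πF x) (πF y) := by positivity
    simpa using by linarith
  | succ n ih =>
    by_cases hxy : x 0 = y 0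
    · rw [hπF.eq_map_shift hK x, hπF.eq_map_shift hK y, hπG.eq_map_shift hK' x,
        hπG.eq_map_shift hK' y, ← hxy, hf, hg]
      calc r (x 0) * dist (πG (shiftWord x)) (πG (shiftWord y))
          ≤ r (x 0) * (C * dist (πF (shiftWord x)) (πF (shiftWord y)) + ρ ^ n * M) :=
            mul_le_mul_of_nonneg_left (ih _ _) (hr _).1.le
        _ = C * (r (x 0) * dist (πF (shiftWord x)) (πF (shiftWord y)))
            + r (x 0) * (ρ ^ n * M) := by ring
        _ ≤ C * (r (x 0) * dist (πF (shiftWord x)) (πF (shiftWord y)))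
            + ρ * (ρ ^ n * M) := by
            gcongr
            exact hrρ _
        _ = _ := by rw [pow_succ]; ring
    · have h3 : 0 ≤ ρ ^ (n + 1) * M := by positivity
      linarith [hbase x y hxy]

/-- **Theorem (Lipschitz equivalence).**
If `F` and `G` are p.c.f. IFSs of contracting similitudes on complete metric spaces,
both satisfying the SIC and the ASC, with the same topology automaton and with equal
contraction ratios `r_i = r'_i`, then their attractors are Lipschitz equivalent. -/
theorem lipschitz_equivalence_of_same_automaton_same_ratios
    {X Y : Type*} [MetricSpace X] [MetricSpace Y] [CompleteSpace X] [CompleteSpace Y]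
    {N : ℕ} (f : Fin N → X → X) (g : Fin N → Y → Y) (K : Set X) (K' : Set Y)
    (r r' : Fin N → ℝ)
    (hr : ∀ i, 0 < r i ∧ r i < 1) (hr' : ∀ i, 0 < r' i ∧ r' i < 1)
    (hf : ∀ i, IsSimilitude (f i) (r i)) (hg : ∀ i, IsSimilitude (g i) (r' i))
    (πF : (ℕ → Fin N) → X) (πG : (ℕ → Fin N) → Y)
    (hK : IsAttractor f K) (hK' : IsAttractor g K')
    (hπF : IsCodingMap f K πF) (hπG : IsCodingMap g K' πG)
    (hpcfF : (πF ⁻¹' postCriticalSet f K).Finite)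
    (hpcfG : (πG ⁻¹' postCriticalSet g K').Finite)
    (hSICf : SIC f K) (hSICg : SIC g K')
    (hASCf : ASC f K) (hASCg : ASC g K')
    (hauto : ∀ I J : List (Fin N), I ≠ [] → I.length = J.length →
      ((wordMap f I '' K) ∩ (wordMap f J '' K) = ∅ ↔
        (wordMap g I '' K') ∩ (wordMap g J '' K') = ∅))
    (hratios : ∀ i, r i = r' i) :
    ∃ (h : K ≃ K') (A B : ℝ), 0 < A ∧ A ≤ B ∧
      ∀ x y : K, A * dist x y ≤ dist (h x) (h y) ∧ dist (h x) (h y) ≤ B * dist x y := by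
  obtain rfl : r = r' := funext hratios
  have hFG : ∀ x y, πF x = πF y → πG x = πG y := fun x y =>
    codingMap_eq_of_codingMap_eq hr hg hK' hπF hπG fun I J hI hIJ => (hauto I J hI hIJ).2
  have hGF : ∀ x y, πG x = πG y → πF x = πF y := fun x y =>
    codingMap_eq_of_codingMap_eq hr hf hK hπG hπF fun I J hI hIJ => (hauto I J hI hIJ).1
  obtain ⟨B, hB, hle⟩ := exists_dist_codingMap_le_mul_dist
    hr hf hg hK hK' hπF hπG hpcfF hSICf hASCf hFG
  obtain ⟨C, hC, hge⟩ := exists_dist_codingMap_le_mul_dist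
    hr hg hf hK' hK hπG hπF hpcfG hSICg hASCg hGF
  choose u hu using fun p : K => hπF.surjOn hK p.2
  choose v hv using fun q : K' => hπG.surjOn hK' q.2
  let h : K ≃ K' :=
    { toFun := fun p => ⟨πG (u p), hπG.mem hK' _⟩
      invFun := fun q => ⟨πF (v q), hπF.mem hK _⟩
      left_inv := fun p => Subtype.ext ((hGF _ _ (hv _)).trans (hu p))
      right_inv := fun q => Subtype.ext ((hFG _ _ (hu _)).trans (hv q)) }
  refine ⟨h, min C⁻¹ B, B, by positivity, min_le_right _ _, fun x y => ⟨?_, ?_⟩⟩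
  · have h1 : dist x y ≤ C * dist (h x) (h y) := by
      have := hge (u x) (u y)
      rwa [hu, hu] at this
    calc min C⁻¹ B * dist x y ≤ C⁻¹ * dist x y := by gcongr; exact min_le_left _ _
      _ ≤ dist (h x) (h y) := by rwa [inv_mul_le_iff₀ hC]
  · have := hle (u x) (u y)
    rwa [hu, hu] at this
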